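/- arXiv:1810.01654 — 2 statements merged into one kernel-verified Lean document; each statement's English description precedes it below -/
import Mathlib

section
/- Let L be an orthomodular σ-lattice and let p be an s-map on L. If a, b ∈ L are compatible, then p(a,b) = μ_p(a ∧ b) = p(b,a). -/
/-- A σ-complete orthomodular lattice (σ-OML): a bounded lattice (with distinct
least element `⊥` and greatest element `⊤`) equipped with an orthocomplementation
`compl` satisfying the orthomodular law, in which every countable family of
elements has a least upper bound. -/
class SigmaOML (L : Type) extends Lattice L, BoundedOrder L where
  compl : L → L
  compl_compl : ∀ a : L, compl (compl a) = a
  sup_compl : ∀ a : L, a ⊔ compl a = ⊤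
  compl_antitone : ∀ a b : L, a ≤ b → compl b ≤ compl a
  orthomodular : ∀ a b : L, a ≤ b → b = a ⊔ compl a ⊓ b
  bot_ne_top : (⊥ : L) ≠ ⊤
  exists_countable_lub : ∀ f : ℕ → L, ∃ s : L, IsLUB (Set.range f) s

/-- `a` is orthogonal to `b` (`a ⊥ b`) if `a ≤ b'`. -/
def SigmaOML.Orthogonal {L : Type} [SigmaOML L] (a b : L) : Prop :=
  a ≤ SigmaOML.compl b

/-- `a` and `b` are compatible (`a ↔ b`) if `a = (a ∧ b) ∨ (a ∧ b')` and
`b = (a ∧ b) ∨ (a' ∧ b)`. -/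
def SigmaOML.Compatible {L : Type} [SigmaOML L] (a b : L) : Prop :=
  a = a ⊓ b ⊔ a ⊓ SigmaOML.compl b ∧ b = a ⊓ b ⊔ SigmaOML.compl a ⊓ b

/-- A σ-additive state on a σ-OML `L`: a map `m : L → [0,1]` with `m ⊤ = 1` which is
σ-additive on every at most countable family of pairwise orthogonal elements. -/
structure OMLState (L : Type) [SigmaOML L] where
  toFun : L → ℝ
  nonneg : ∀ a, 0 ≤ toFun a
  le_one : ∀ a, toFun a ≤ 1
  map_top : toFun ⊤ = 1
  additive : ∀ {ι : Type} [Countable ι] (f : ι → L) (s : L),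
    (∀ i j, i ≠ j → SigmaOML.Orthogonal (f i) (f j)) →
    IsLUB (Set.range f) s →
    HasSum (fun i => toFun (f i)) (toFun s)

/-- An s-map on a σ-OML `L`: a map `p : L × L → [0,1]` with `p(⊤,⊤) = 1`, vanishing on
orthogonal pairs, and σ-additive in each variable on at most countable families of
pairwise orthogonal elements. -/
structure OMLSMap (L : Type) [SigmaOML L] where
  toFun : L → L → ℝ
  nonneg : ∀ a b, 0 ≤ toFun a b
  le_one : ∀ a b, toFun a b ≤ 1
  map_top_top : toFun ⊤ ⊤ = 1
  orthogonal_eq_zero : ∀ a b, SigmaOML.Orthogonal a b → toFun a b = 0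
  additive_left : ∀ {ι : Type} [Countable ι] (f : ι → L) (s b : L),
    (∀ i j, i ≠ j → SigmaOML.Orthogonal (f i) (f j)) →
    IsLUB (Set.range f) s →
    HasSum (fun i => toFun (f i) b) (toFun s b)
  additive_right : ∀ {ι : Type} [Countable ι] (f : ι → L) (s b : L),
    (∀ i j, i ≠ j → SigmaOML.Orthogonal (f i) (f j)) →
    IsLUB (Set.range f) s →
    HasSum (fun i => toFun b (f i)) (toFun b s)

namespace SigmaOML

variable {L : Type} [SigmaOML L]

theorem Orthogonal.symm {a b : L} (h : Orthogonal a b) : Orthogonal b a := by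
  have h' := compl_antitone _ _ h
  rwa [compl_compl] at h'

theorem Orthogonal.mono {a b c d : L} (h : Orthogonal c d) (hac : a ≤ c) (hbd : b ≤ d) :
    Orthogonal a b :=
  hac.trans (h.trans (compl_antitone _ _ hbd))

theorem orthogonal_compl (a : L) : Orthogonal a (compl a) :=
  (compl_compl a).ge

theorem Orthogonal.pairwise_cond {a b : L} (h : Orthogonal a b) (i j : Bool) (hij : i ≠ j) :
    Orthogonal (cond i a b) (cond j a b) := by
  cases i <;> cases j
  · exact absurd rfl hij
  · exact h.symm
  · exact h
  · exact absurd rfl hij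

theorem isLUB_range_cond (a b : L) : IsLUB (Set.range fun i : Bool => cond i a b) (a ⊔ b) := by
  rw [Bool.range_eq, Set.pair_comm]
  exact isLUB_pair

theorem Compatible.symm {a b : L} (h : Compatible a b) : Compatible b a := by
  constructor
  · rw [inf_comm b a, inf_comm b (compl a)]
    exact h.2
  · rw [inf_comm b a, inf_comm (compl b) a]
    exact h.1

end SigmaOML

namespace OMLSMap

open SigmaOML

variable {L : Type} [SigmaOML L] (p : OMLSMap L)

theorem map_sup_left {a b : L} (h : Orthogonal a b) (c : L) :
    p.toFun (a ⊔ b) c = p.toFun a c + p.toFun b c := by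
  have hs := p.additive_left _ _ c h.pairwise_cond (isLUB_range_cond a b)
  simpa using hs.unique (hasSum_fintype _)

theorem map_sup_right {a b : L} (h : Orthogonal a b) (c : L) :
    p.toFun c (a ⊔ b) = p.toFun c a + p.toFun c b := by
  have hs := p.additive_right _ _ c h.pairwise_cond (isLUB_range_cond a b)
  simpa using hs.unique (hasSum_fintype _)

theorem eq_map_inf_of_compatible {a b : L} (hab : Compatible a b) :
    p.toFun a b = p.toFun (a ⊓ b) (a ⊓ b) := by
  have hleft : Orthogonal (a ⊓ b) (a ⊓ compl b) :=
    (orthogonal_compl b).mono inf_le_right inf_le_right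
  have hright : Orthogonal (a ⊓ b) (compl a ⊓ b) :=
    (orthogonal_compl a).mono inf_le_left inf_le_left
  have hb : Orthogonal (a ⊓ compl b) b :=
    (orthogonal_compl b).symm.mono inf_le_right le_rfl
  calc
    p.toFun a b = p.toFun (a ⊓ b ⊔ a ⊓ compl b) b := by rw [← hab.1]
    _ = p.toFun (a ⊓ b) b := by
      rw [p.map_sup_left hleft, p.orthogonal_eq_zero _ _ hb, add_zero]
    _ = p.toFun (a ⊓ b) (a ⊓ b ⊔ compl a ⊓ b) := by rw [← hab.2]
    _ = p.toFun (a ⊓ b) (a ⊓ b) := by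
      rw [p.map_sup_right hright, p.orthogonal_eq_zero _ _ hright, add_zero]

end OMLSMap

/-- If `a` and `b` are compatible elements of a σ-OML `L` and `p` is an
s-map on `L`, then `p(a,b) = μ_p(a ∧ b) = p(b,a)`. -/
theorem sMap_of_compatible {L : Type} [SigmaOML L] (p : OMLSMap L) (a b : L)
    (hab : SigmaOML.Compatible a b) :
    p.toFun a b = p.toFun (a ⊓ b) (a ⊓ b) ∧
    p.toFun b a = p.toFun (a ⊓ b) (a ⊓ b) := by
  refine ⟨p.eq_map_inf_of_compatible hab, ?_⟩
  rw [inf_comm a b]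
  exact p.eq_map_inf_of_compatible hab.symm
end

section
/- Let L be an orthomodular σ-lattice and let p be an s-map on L. If a, b ∈ L are p-causal, i.e. p(a,b) ≠ p(b,a), then μ_p(a) < 1 and μ_p(b) < 1. Equivalently, if μ_p(a) = 1 then p(a,c) = p(c,a) for all c ∈ L. -/
open SigmaOML in
theorem SigmaOML.orthogonal_compl_right {L : Type} [SigmaOML L] (a : L) :
    Orthogonal a (compl a) :=
  (compl_compl a).ge

open SigmaOML in
theorem SigmaOML.orthogonal_compl_left {L : Type} [SigmaOML L] (a : L) :
    Orthogonal (compl a) a :=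
  le_refl (compl a)

/-- The family consisting of an element and its orthocomplement. -/
def SigmaOML.complPair {L : Type} [SigmaOML L] (a : L) (i : Bool) : L :=
  cond i a (SigmaOML.compl a)

open SigmaOML in
theorem SigmaOML.complPair_orthogonal {L : Type} [SigmaOML L] (a : L) (i j : Bool) (h : i ≠ j) :
    Orthogonal (complPair a i) (complPair a j) := by
  cases i <;> cases j
  · exact absurd rfl h
  · exact orthogonal_compl_left a
  · exact orthogonal_compl_right a
  · exact absurd rfl h

open SigmaOML in
theorem SigmaOML.isLUB_range_complPair {L : Type} [SigmaOML L] (a : L) :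
    IsLUB (Set.range (complPair a)) ⊤ := by
  refine ⟨fun _ _ => le_top, fun u hu => ?_⟩
  rw [← sup_compl a]
  exact sup_le (hu ⟨true, rfl⟩) (hu ⟨false, rfl⟩)

namespace OMLSMap

open SigmaOML

variable {L : Type} [SigmaOML L] (p : OMLSMap L)

theorem add_compl_left (a c : L) : p.toFun a c + p.toFun (compl a) c = p.toFun ⊤ c := by
  have h := p.additive_left (complPair a) ⊤ c (complPair_orthogonal a) (isLUB_range_complPair a)
  simpa [complPair] using (hasSum_fintype _).unique h

theorem add_compl_right (a c : L) : p.toFun c a + p.toFun c (compl a) = p.toFun c ⊤ := by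
  have h := p.additive_right (complPair a) ⊤ c (complPair_orthogonal a) (isLUB_range_complPair a)
  simpa [complPair] using (hasSum_fintype _).unique h

theorem top_left (c : L) : p.toFun ⊤ c = p.toFun c c := by
  rw [← p.add_compl_left c c, p.orthogonal_eq_zero _ _ (orthogonal_compl_left c), add_zero]

theorem top_right (c : L) : p.toFun c ⊤ = p.toFun c c := by
  rw [← p.add_compl_right c c, p.orthogonal_eq_zero _ _ (orthogonal_compl_right c), add_zero]

theorem symm_of_self_eq_one {a : L} (ha : p.toFun a a = 1) (c : L) :
    p.toFun a c = p.toFun c a := by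
  have hcompl : p.toFun (compl a) (compl a) = 0 := by
    have := p.add_compl_left a ⊤
    rw [p.top_right, p.top_right, p.map_top_top, ha] at this
    linarith
  have hleft : p.toFun (compl a) c = 0 := by
    have := p.add_compl_right c (compl a)
    rw [p.top_right, hcompl] at this
    linarith [p.nonneg (compl a) c, p.nonneg (compl a) (compl c)]
  have hright : p.toFun c (compl a) = 0 := by
    have := p.add_compl_left c (compl a)
    rw [p.top_left, hcompl] at this
    linarith [p.nonneg c (compl a), p.nonneg (compl c) (compl a)]
  linarith [p.add_compl_left a c, p.add_compl_right a c, p.top_left c, p.top_right c]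

end OMLSMap

/-- For an s-map `p` on a σ-OML `L`: if `a, b` are `p`-causal, i.e.
`p(a,b) ≠ p(b,a)`, then `μ_p(a) < 1` and `μ_p(b) < 1`; equivalently, if `μ_p(a) = 1`
then `p(a,c) = p(c,a)` for all `c ∈ L`. -/
theorem causal_implies_mu_lt_one {L : Type} [SigmaOML L] (p : OMLSMap L) :
    (∀ a b : L, p.toFun a b ≠ p.toFun b a → p.toFun a a < 1 ∧ p.toFun b b < 1) ∧
    (∀ a : L, p.toFun a a = 1 → ∀ c : L, p.toFun a c = p.toFun c a) := by
  refine ⟨fun a b hab => ⟨?_, ?_⟩, fun a ha c => p.symm_of_self_eq_one ha c⟩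
  · exact lt_of_le_of_ne (p.le_one a a) fun ha => hab (p.symm_of_self_eq_one ha b)
  · exact lt_of_le_of_ne (p.le_one b b) fun hb => hab (p.symm_of_self_eq_one hb a).symm
end
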